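/- arXiv:2508.20650 — 2 statements merged into one kernel-verified Lean document; each statement's English description precedes it below -/
import Mathlib

section
/- Universal approximation by self-composing neural operators (Theorem 2.1): Let X and Y be real Hilbert spaces with X separable, let C ⊆ X be a compact set, and let O* : X → Y be continuous on C. Let Z = C([0,1], ℝ) be the Banach space of continuous real-valued functions on the unit interval with the supremum norm, and let σ denote the pointwise ReLU activation, i.e. σ(f)(t) = max(f(t), 0), applied componentwise on finite products Z^N. Then for every positive integer n and every ε > 0 there exist positive integers Ñ, N, L, continuous linear maps 𝓛 : X → Z^Ñ and 𝓟 : Z^Ñ → Y, continuous linear operators W¹ : Z^Ñ → Z^N, Wˡ : Z^N → Z^N for 2 ≤ ℓ ≤ L−1, and W^L : Z^N → Z^Ñ, together with elements B¹,…,B^{L−1} ∈ Z^N and B^L ∈ Z^Ñ, such that the operator G : Z^Ñ → Z^Ñ defined by G(v) = σ(W^L σ( ⋯ σ(W¹ v + B¹) ⋯ ) + B^L) satisfies sup_{v ∈ C} ‖ O*(v) − 𝓟( G^[n]( 𝓛(v) ) ) ‖_Y ≤ ε, where G^[n] denotes the n-fold composition of G with itself. -/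
/-- The latent function space `Z = C([0,1], ℝ)` with the supremum norm. -/
abbrev LatentZ : Type := C(unitInterval, ℝ)

/-- Pointwise ReLU on `Z`: `σ(f)(t) = max (f t) 0`. -/
noncomputable def zRelu (f : LatentZ) : LatentZ := f ⊔ 0

/-- Componentwise pointwise ReLU on `Z^b`. -/
noncomputable def vRelu {b : ℕ} (v : Fin b → LatentZ) : Fin b → LatentZ :=
  fun i => zRelu (v i)

/-- A single neural-operator layer `h ↦ σ (W h + B)`, with `W` a continuous
linear operator between finite products of `Z`, `B` an element of such a
product, and `σ` the componentwise pointwise ReLU. -/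
noncomputable def opLayer {a b : ℕ}
    (W : (Fin a → LatentZ) →L[ℝ] (Fin b → LatentZ)) (B : Fin b → LatentZ)
    (v : Fin a → LatentZ) : Fin b → LatentZ :=
  vRelu (W v + B)

/-- A stack of `M` hidden layers `Z^N → Z^N`, applied in order of index. -/
noncomputable def midStack {N : ℕ} :
    (M : ℕ) → (Fin M → ((Fin N → LatentZ) →L[ℝ] (Fin N → LatentZ))) →
      (Fin M → (Fin N → LatentZ)) → (Fin N → LatentZ) → (Fin N → LatentZ)
  | 0, _, _ => id
  | M + 1, W, B =>
      opLayer (W (Fin.last M)) (B (Fin.last M)) ∘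
        midStack M (fun i => W i.castSucc) (fun i => B i.castSucc)

/-- Finite sums of ridge exponentials are dense in the real-valued continuous functions on a
compact subset of a Hilbert space. -/
theorem topologicalClosure_span_exp_eq_top {X : Type*} [NormedAddCommGroup X]
    [InnerProductSpace ℝ X] (C : Set X) [CompactSpace C] :
    (Submodule.span ℝ {g : C(C, ℝ) | ∃ ℓ : X →L[ℝ] ℝ, ∀ x, g x = Real.exp (ℓ x)}).topologicalClosure
      = ⊤ := by
  set S : Set C(C, ℝ) := {g | ∃ ℓ : X →L[ℝ] ℝ, ∀ x, g x = Real.exp (ℓ x)} with hS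
  have hsub : ((Submonoid.closure S : Submonoid C(C, ℝ)) : Set C(C, ℝ)) ⊆ Submodule.span ℝ S := by
    intro g hg
    refine Submodule.subset_span ?_
    induction hg using Submonoid.closure_induction with
    | mem g hg => exact hg
    | one => exact ⟨0, fun x => by simp⟩
    | mul f g _ _ hf hg =>
      obtain ⟨a, ha⟩ := hf
      obtain ⟨b, hb⟩ := hg
      exact ⟨a + b, fun x => by simp [ha, hb, Real.exp_add]⟩
  have hsep : (Algebra.adjoin ℝ S).SeparatesPoints := by
    intro x y hxy
    have hmem : (⟨fun z : C => Real.exp (innerSL ℝ ((x : X) - y) z), by fun_prop⟩ : C(C, ℝ)) ∈ S :=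
      ⟨innerSL ℝ ((x : X) - y), fun _ => rfl⟩
    refine ⟨_, ⟨_, Algebra.subset_adjoin hmem, rfl⟩, fun h => hxy ?_⟩
    have h' : inner ℝ ((x : X) - y) (x : X) = inner ℝ ((x : X) - y) (y : X) :=
      Real.exp_injective h
    rw [← sub_eq_zero, ← inner_sub_right, inner_self_eq_zero, sub_eq_zero] at h'
    exact Subtype.ext h'
  have htop := ContinuousMap.subalgebra_topologicalClosure_eq_top_of_separatesPoints _ hsep
  have hspan := Algebra.adjoin_eq_span_of_subset ℝ hsub
  refine SetLike.ext' ?_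
  have := congrArg (fun A : Subalgebra ℝ C(C, ℝ) => (A : Set C(C, ℝ))) htop
  have hset : ((Algebra.adjoin ℝ S : Subalgebra ℝ C(C, ℝ)) : Set C(C, ℝ)) =
      (Submodule.span ℝ S : Set C(C, ℝ)) :=
    congrArg (fun p : Submodule ℝ C(C, ℝ) => (p : Set C(C, ℝ))) hspan
  simpa [Subalgebra.topologicalClosure_coe, Submodule.topologicalClosure_coe, hset] using this

/-- A continuous map from a compact space to a Hilbert space is uniformly approximated by its
projections to finite-dimensional subspaces. -/
theorem exists_sum_smul_approx {K Y : Type*} [TopologicalSpace K] [CompactSpace K]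
    [NormedAddCommGroup Y] [InnerProductSpace ℝ Y] (f : C(K, Y)) {ε : ℝ} (hε : 0 < ε) :
    ∃ (m : ℕ) (g : Fin m → C(K, ℝ)) (y : Fin m → Y), ∀ x, ‖f x - ∑ i, g i x • y i‖ ≤ ε := by
  obtain ⟨t, ht, hcov⟩ :=
    Metric.totallyBounded_iff.1 (isCompact_range f.continuous).totallyBounded ε hε
  let V : Submodule ℝ Y := Submodule.span ℝ t
  have : FiniteDimensional ℝ V := FiniteDimensional.span_of_finite ℝ ht
  let b := stdOrthonormalBasis ℝ V
  refine ⟨_, fun i => ⟨fun x => inner ℝ ((b i : V) : Y) (f x), by fun_prop⟩,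
    fun i => ((b i : V) : Y), fun x => ?_⟩
  have hx := hcov (Set.mem_range_self x)
  simp only [Set.mem_iUnion, Metric.mem_ball, exists_prop] at hx
  obtain ⟨z, hz, hxz⟩ := hx
  have hsum : ∑ i, inner ℝ ((b i : V) : Y) (f x) • ((b i : V) : Y) = V.starProjection (f x) := by
    rw [Submodule.starProjection_apply, b.orthogonalProjectionOnto_apply_eq_sum]
    simp
  simp only [ContinuousMap.coe_mk, hsum]
  rw [Submodule.starProjection_minimal]
  refine (ciInf_le ⟨0, ?_⟩ (⟨z, Submodule.subset_span hz⟩ : V)).trans ?_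
  · rintro _ ⟨w, rfl⟩
    exact norm_nonneg _
  · rw [← dist_eq_norm]
    exact hxz.le

/-- Uniform approximation of Hilbert-space-valued functions by ridge exponentials. -/
theorem exists_sum_exp_smul_approx {X Y : Type*} [NormedAddCommGroup X] [InnerProductSpace ℝ X]
    [NormedAddCommGroup Y] [InnerProductSpace ℝ Y] {C : Set X} (hC : IsCompact C) {f : X → Y}
    (hf : ContinuousOn f C) {ε : ℝ} (hε : 0 < ε) :
    ∃ (m : ℕ) (ℓ : Fin m → X →L[ℝ] ℝ) (y : Fin m → Y),
      ∀ x ∈ C, ‖f x - ∑ i, Real.exp (ℓ i x) • y i‖ ≤ ε := by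
  have : CompactSpace C := isCompact_iff_compactSpace.1 hC
  let S : Set C(C, Y) := {g | ∃ (ℓ : X →L[ℝ] ℝ) (y : Y), ∀ x, g x = Real.exp (ℓ x) • y}
  let T : Submodule ℝ C(C, Y) := (Submodule.span ℝ S).topologicalClosure
  have hsmul (g : C(C, ℝ)) (y : Y) :
      (ContinuousLinearMap.toSpanSingleton ℝ y).compLeftContinuous ℝ C g ∈ T := by
    have hg : g ∈ closure (Submodule.span ℝ
        {g : C(C, ℝ) | ∃ ℓ : X →L[ℝ] ℝ, ∀ x, g x = Real.exp (ℓ x)} : Set C(C, ℝ)) := by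
      rw [← Submodule.topologicalClosure_coe, topologicalClosure_span_exp_eq_top]
      trivial
    refine map_mem_closure (ContinuousLinearMap.continuous _) hg fun g hg => ?_
    induction hg using Submodule.span_induction with
    | mem g hg =>
      obtain ⟨ℓ, hℓ⟩ := hg
      exact Submodule.subset_span ⟨ℓ, y, fun x => by simp [hℓ]⟩
    | zero => simp
    | add a b _ _ ha hb => rw [map_add]; exact Submodule.add_mem _ ha hb
    | smul c a _ ha => rw [map_smul]; exact Submodule.smul_mem _ c ha
  let F : C(C, Y) := ⟨C.domRestrict f, hf.domRestrict⟩
  obtain ⟨k, g, z, hgz⟩ := exists_sum_smul_approx F (half_pos hε)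
  have hT : ∑ i, (ContinuousLinearMap.toSpanSingleton ℝ (z i)).compLeftContinuous ℝ C (g i) ∈ T :=
    Submodule.sum_mem _ fun i _ => hsmul _ _
  obtain ⟨h, hh, hdist⟩ := Metric.mem_closure_iff.1 hT (ε / 2) (half_pos hε)
  obtain ⟨m, c, s, rfl⟩ := Submodule.mem_span_set'.1 hh
  choose ℓ y hs using fun i => (s i).2
  refine ⟨m, ℓ, fun i => c i • y i, fun x hx => ?_⟩
  have h1 := hgz ⟨x, hx⟩
  have h2 := (ContinuousMap.dist_apply_le_dist ⟨x, hx⟩).trans hdist.le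
  rw [dist_eq_norm] at h2
  simp only [ContinuousMap.sum_apply, ContinuousMap.smul_apply, hs,
    ContinuousLinearMap.compLeftContinuous_apply] at h2
  simp_rw [smul_comm _ (c _)]
  calc _ = ‖(F ⟨x, hx⟩ - ∑ i, g i ⟨x, hx⟩ • z i)
        + (∑ i, g i ⟨x, hx⟩ • z i - ∑ i, c i • Real.exp (ℓ i x) • y i)‖ := by
        simp [F]
    _ ≤ ε / 2 + ε / 2 := norm_add_le_of_le h1 h2
    _ = ε := add_halves ε

/-- Integration against a continuous weight, as a functional on the latent space. -/
theorem exists_clm_eq_integral_mul {w : ℝ → ℝ} (hw : Continuous w) :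
    ∃ Φ : LatentZ →L[ℝ] ℝ, ∀ f,
      Φ f = ∫ t in (0 : ℝ)..1, f (Set.projIcc 0 1 zero_le_one t) * w t := by
  obtain ⟨M, hM⟩ := (isCompact_Icc (a := (0 : ℝ)) (b := 1)).exists_bound_of_continuousOn
    hw.continuousOn
  have hint (f : LatentZ) : IntervalIntegrable
      (fun t => f (Set.projIcc 0 1 zero_le_one t) * w t) MeasureTheory.volume 0 1 :=
    ((f.continuous.comp continuous_projIcc).mul hw).intervalIntegrable 0 1
  refine ⟨LinearMap.mkContinuousOfExistsBound
    { toFun := fun f => ∫ t in (0 : ℝ)..1, f (Set.projIcc 0 1 zero_le_one t) * w t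
      map_add' := fun f g => by
        simp only [ContinuousMap.add_apply, add_mul]
        exact intervalIntegral.integral_add (hint f) (hint g)
      map_smul' := fun c f => by
        simp [mul_assoc] } ⟨M, fun f => ?_⟩, fun f => rfl⟩
  have := intervalIntegral.norm_integral_le_of_norm_le_const (a := 0) (b := 1) (C := M * ‖f‖)
    (f := fun t => f (Set.projIcc 0 1 zero_le_one t) * w t) fun t ht => by
      rw [Set.uIoc_of_le zero_le_one] at ht
      rw [norm_mul, mul_comm]
      exact mul_le_mul (hM t ⟨ht.1.le, ht.2⟩) (f.norm_coe_le_norm _) (norm_nonneg _)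
        ((norm_nonneg _).trans (hM t ⟨ht.1.le, ht.2⟩))
  simpa using this

/-- The exponential as a superposition of rectified shifts with thresholds in `[-2R, R]`. -/
theorem integral_max_sub_mul_exp {R u : ℝ} (hR : 0 < R) (hu : |u| ≤ R) :
    ∫ t in (0 : ℝ)..1, max (u - R * (3 * t - 2)) 0 * (3 * R * Real.exp (R * (3 * t - 2))) =
      Real.exp u - Real.exp (-(2 * R)) * (1 + u + 2 * R) := by
  obtain ⟨h1, h2⟩ := abs_le.1 hu
  set s : ℝ := (u / R + 2) / 3 with hs
  have hsu : R * (3 * s - 2) = u := by rw [hs]; field_simp; ring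
  have hs0 : 0 ≤ s := by nlinarith
  have hs1 : s ≤ 1 := by nlinarith
  have hcont : Continuous fun t : ℝ =>
      max (u - R * (3 * t - 2)) 0 * (3 * R * Real.exp (R * (3 * t - 2))) := by fun_prop
  rw [← intervalIntegral.integral_add_adjacent_intervals (hcont.intervalIntegrable 0 s)
    (hcont.intervalIntegrable s 1)]
  have hright : ∫ t in s..1, max (u - R * (3 * t - 2)) 0 *
      (3 * R * Real.exp (R * (3 * t - 2))) = 0 := by
    rw [intervalIntegral.integral_congr (g := fun _ => (0 : ℝ)) fun t ht => ?_]
    · simp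
    · rw [Set.uIcc_of_le hs1] at ht
      have : u - R * (3 * t - 2) ≤ 0 := by nlinarith [ht.1]
      simp [max_eq_right this]
  have hleft : ∫ t in (0 : ℝ)..s, max (u - R * (3 * t - 2)) 0 *
      (3 * R * Real.exp (R * (3 * t - 2))) =
      ∫ t in (0 : ℝ)..s, (u - R * (3 * t - 2)) * (3 * R * Real.exp (R * (3 * t - 2))) := by
    refine intervalIntegral.integral_congr fun t ht => ?_
    rw [Set.uIcc_of_le hs0] at ht
    have : 0 ≤ u - R * (3 * t - 2) := by nlinarith [ht.2]
    simp [max_eq_left this]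
  have hderiv (t : ℝ) : HasDerivAt
      (fun t => (u - R * (3 * t - 2) + 1) * Real.exp (R * (3 * t - 2)))
      ((u - R * (3 * t - 2)) * (3 * R * Real.exp (R * (3 * t - 2)))) t := by
    have hτ : HasDerivAt (fun t : ℝ => R * (3 * t - 2)) (R * (3 * 1)) t :=
      (((hasDerivAt_id t).const_mul 3).sub_const 2).const_mul R
    convert! ((hτ.const_sub u).add_const 1).mul hτ.exp using 1
    ring
  rw [hright, hleft, intervalIntegral.integral_eq_sub_of_hasDerivAt (fun t _ => hderiv t)
    ((by fun_prop : Continuous fun t : ℝ => (u - R * (3 * t - 2)) *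
      (3 * R * Real.exp (R * (3 * t - 2)))).intervalIntegrable 0 s), hsu]
  have h0 : R * (3 * 0 - 2) = -(2 * R) := by ring
  rw [h0]
  ring

/-- A single rectified shift of a constant function retains the constant, and linearly yields its
exponential. -/
theorem exists_zRelu_decoders {R : ℝ} (hR : 0 < R) :
    ∃ (τ : LatentZ) (e Φ : LatentZ →L[ℝ] ℝ), (∀ u : ℝ, e (u • 1) = u) ∧
      ∀ u : ℝ, |u| ≤ R →
        e (zRelu (u • 1 - τ)) = u ∧ Φ (zRelu (u • 1 - τ)) = Real.exp u := by
  let τ : LatentZ := ⟨fun t => R * (3 * (t : ℝ) - 2), by fun_prop⟩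
  let p : unitInterval := ⟨1 / 3, by norm_num, by norm_num⟩
  let e₀ : LatentZ →L[ℝ] ℝ := ContinuousMap.evalCLM ℝ 0
  let e₁ : LatentZ →L[ℝ] ℝ := ContinuousMap.evalCLM ℝ p
  obtain ⟨I, hI⟩ := exists_clm_eq_integral_mul
    (w := fun t : ℝ => 3 * R * Real.exp (R * (3 * t - 2))) (by fun_prop)
  refine ⟨τ, (2 : ℝ) • e₁ - e₀, I + Real.exp (-(2 * R)) • (e₀ + R⁻¹ • (e₀ - e₁)), fun u => ?_,
    fun u hu => ?_⟩
  · simp [e₀, e₁]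
    ring
  · obtain ⟨h1, h2⟩ := abs_le.1 hu
    have hval (t : unitInterval) :
        zRelu (u • 1 - τ) t = max (u - R * (3 * (t : ℝ) - 2)) 0 := by
      simp [zRelu, τ]
    have hv₀ : e₀ (zRelu (u • 1 - τ)) = u + 2 * R := by
      change zRelu (u • 1 - τ) 0 = _
      rw [hval, max_eq_left] <;> simp <;> linarith
    have hv₁ : e₁ (zRelu (u • 1 - τ)) = u + R := by
      change zRelu (u • 1 - τ) p = _
      rw [hval, max_eq_left] <;> simp only [p] <;> linarith
    have hvI : I (zRelu (u • 1 - τ)) =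
        Real.exp u - Real.exp (-(2 * R)) * (1 + u + 2 * R) := by
      rw [hI, ← integral_max_sub_mul_exp hR hu]
      refine intervalIntegral.integral_congr fun t ht => ?_
      rw [Set.uIcc_of_le zero_le_one] at ht
      simp only [hval, Set.projIcc_of_mem zero_le_one ht]
    constructor
    · simp only [sub_apply, smul_apply, hv₀, hv₁,
        smul_eq_mul]
      ring
    · simp only [add_apply, sub_apply,
        smul_apply, hv₀, hv₁, hvI, smul_eq_mul]
      field_simp
      ring

/-- **Universal approximation by self-composing neural operators
(Theorem 2.1).**  Let `X, Y` be real Hilbert spaces with `X` separable,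
`C ⊆ X` compact, and `O* : X → Y` continuous on `C`.  Then for every `n ≥ 1`
and `ε > 0` there exist positive integers `Ñ, N, L`, continuous linear maps
`𝓛 : X → Z^Ñ`, `𝓟 : Z^Ñ → Y`, and a ReLU neural operator
`G(v) = σ(W^L σ(⋯ σ(W¹ v + B¹) ⋯) + B^L)` (with `W¹ : Z^Ñ → Z^N`,
`L − 2` middle layers `Wˡ : Z^N → Z^N` for `2 ≤ ℓ ≤ L − 1`, and
`W^L : Z^N → Z^Ñ`) such that
`sup_{v ∈ C} ‖O*(v) − 𝓟 (G^[n] (𝓛 v))‖ ≤ ε`. -/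
theorem universal_approximation_self_composing_neural_operator
    {X Y : Type*}
    [NormedAddCommGroup X] [InnerProductSpace ℝ X] [CompleteSpace X]
    [TopologicalSpace.SeparableSpace X]
    [NormedAddCommGroup Y] [InnerProductSpace ℝ Y] [CompleteSpace Y]
    (C : Set X) (hC : IsCompact C) (Ostar : X → Y)
    (hcont : ContinuousOn Ostar C)
    (n : ℕ) (hn : 0 < n) (ε : ℝ) (hε : 0 < ε) :
    ∃ (Ntil N L : ℕ), 0 < Ntil ∧ 0 < N ∧ 0 < L ∧
      ∃ (𝓛 : X →L[ℝ] (Fin Ntil → LatentZ))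
        (𝓟 : (Fin Ntil → LatentZ) →L[ℝ] Y)
        (W1 : (Fin Ntil → LatentZ) →L[ℝ] (Fin N → LatentZ))
        (B1 : Fin N → LatentZ)
        (Wmid : Fin (L - 2) → ((Fin N → LatentZ) →L[ℝ] (Fin N → LatentZ)))
        (Bmid : Fin (L - 2) → (Fin N → LatentZ))
        (WL : (Fin N → LatentZ) →L[ℝ] (Fin Ntil → LatentZ))
        (BL : Fin Ntil → LatentZ),
        ∀ v ∈ C,
          ‖Ostar v -
              𝓟 ((fun h => opLayer WL BL
                    (midStack (L - 2) Wmid Bmid (opLayer W1 B1 h)))^[n]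
                  (𝓛 v))‖ ≤ ε := by
  obtain ⟨m, ℓ, y, happ⟩ : ∃ (m : ℕ) (ℓ : Fin (m + 1) → X →L[ℝ] ℝ) (y : Fin (m + 1) → Y),
      ∀ x ∈ C, ‖Ostar x - ∑ i, Real.exp (ℓ i x) • y i‖ ≤ ε := by
    obtain ⟨m, ℓ, y, h⟩ := exists_sum_exp_smul_approx hC hcont hε
    exact ⟨m, Fin.cons 0 ℓ, Fin.cons 0 y, fun x hx => by simpa [Fin.sum_univ_succ] using h x hx⟩
  obtain ⟨M, hM⟩ := hC.isBounded.exists_norm_le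
  have hR : 0 < 1 + (∑ i, ‖ℓ i‖) * |M| := by positivity
  obtain ⟨τ, e, Φ, he, hτ⟩ := exists_zRelu_decoders hR
  have hbound (v : X) (hv : v ∈ C) (i : Fin (m + 1)) : |ℓ i v| ≤ 1 + (∑ i, ‖ℓ i‖) * |M| := by
    calc |ℓ i v| ≤ ‖ℓ i‖ * ‖v‖ := (ℓ i).le_opNorm v
      _ ≤ (∑ i, ‖ℓ i‖) * |M| := by
        gcongr
        · exact Finset.single_le_sum (f := fun i => ‖ℓ i‖) (fun _ _ => norm_nonneg _)
            (Finset.mem_univ i)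
        · exact (hM v hv).trans (le_abs_self M)
      _ ≤ _ := by linarith
  let W : (Fin (m + 1) → LatentZ) →L[ℝ] (Fin (m + 1) → LatentZ) :=
    ContinuousLinearMap.pi fun i => (e.smulRight 1).comp (ContinuousLinearMap.proj i)
  refine ⟨m + 1, m + 1, 2, m.succ_pos, m.succ_pos, two_pos,
    ContinuousLinearMap.pi fun i => (ℓ i).smulRight 1,
    ∑ i, (Φ.comp (ContinuousLinearMap.proj i)).smulRight (y i),
    W, fun _ => -τ, fun _ => 0, fun _ => 0, W, fun _ => -τ, fun v hv => ?_⟩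
  let c : Fin (m + 1) → LatentZ := fun i => zRelu (ℓ i v • 1 - τ)
  have hlayer (h : Fin (m + 1) → LatentZ) (hh : ∀ i, e (h i) = ℓ i v) :
      opLayer W (fun _ => -τ) h = c := by
    funext i
    simp [opLayer, vRelu, W, c, hh, sub_eq_add_neg]
  have hc (i : Fin (m + 1)) : e (c i) = ℓ i v := (hτ _ (hbound v hv i)).1
  have hG (h : Fin (m + 1) → LatentZ) (hh : ∀ i, e (h i) = ℓ i v) :
      opLayer W (fun _ => -τ) (midStack (2 - 2) (fun _ => 0) (fun _ => 0)
        (opLayer W (fun _ => -τ) h)) = c := by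
    rw [hlayer h hh]
    exact hlayer c hc
  obtain ⟨k, rfl⟩ := Nat.exists_eq_succ_of_ne_zero hn.ne'
  rw [Function.iterate_succ_apply, hG _ fun i => by simp [he], Function.iterate_fixed (hG c hc)]
  have hΦ (i : Fin (m + 1)) : Φ (c i) = Real.exp (ℓ i v) := (hτ _ (hbound v hv i)).2
  simpa [hΦ] using happ v hv
end

section
/- Quantitative error reduction for self-composing neural operators (Theorem 2.3): Let X and Y be real Hilbert spaces with X separable, let C ⊆ X be a compact set, and let O* : X → Y be Lipschitz continuous on C. Let Z = C([0,1], ℝ) with the supremum norm and let σ be the pointwise ReLU σ(f)(t) = max(f(t), 0), applied componentwise on finite products Z^N. Then for every ε > 0 there exist positive integers Ñ, N, L (depending only on ε, not on n) and a constant C_ε > 0 (depending on ε but independent of n) such that for every integer n ≥ 2 there exist continuous linear maps 𝓛 : X → Z^Ñ and 𝓟 : Z^Ñ → Y and a ReLU neural operator G : Z^Ñ → Z^Ñ of the form G(v) = σ(W^L σ( ⋯ σ(W¹ v + B¹) ⋯ ) + B^L), with W¹ : Z^Ñ → Z^N, Wˡ : Z^N → Z^N for 2 ≤ ℓ ≤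 L−1, W^L : Z^N → Z^Ñ continuous linear and B¹,…,B^{L−1} ∈ Z^N, B^L ∈ Z^Ñ, such that sup_{v ∈ C} ‖ O*(v) − 𝓟( G^[n]( 𝓛(v) ) ) ‖_Y ≤ ε + C_ε / log n. -/
theorem ContinuousMap.submodule_eq_top_of_smul_const_mem {α Y : Type*} [TopologicalSpace α]
    [CompactSpace α] [NormedAddCommGroup Y] [InnerProductSpace ℝ Y]
    (M : Submodule ℝ C(α, Y)) (hM : IsClosed (M : Set C(α, Y)))
    (h : ∀ (g : C(α, ℝ)) (y : Y), g • ContinuousMap.const α y ∈ M) : M = ⊤ := by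
  rw [Submodule.eq_top_iff']
  intro f
  rw [← SetLike.mem_coe, ← hM.closure_eq, Metric.mem_closure_iff]
  intro ε hε
  obtain ⟨t, -, htfin, ht⟩ :=
    (isCompact_range f.continuous).finite_cover_balls (half_pos hε)
  let S : Submodule ℝ Y := Submodule.span ℝ t
  have : FiniteDimensional ℝ S := FiniteDimensional.span_of_finite ℝ htfin
  let b := Module.finBasis ℝ S
  let coord (i : Fin (Module.finrank ℝ S)) : Y →L[ℝ] ℝ :=
    (LinearMap.toContinuousLinearMap (b.coord i)) ∘L S.orthogonalProjectionOnto
  let P : C(α, Y) := ∑ i, (⟨fun x => coord i (f x), by fun_prop⟩ : C(α, ℝ)) •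
    ContinuousMap.const α (b i : Y)
  have hP (x : α) : P x = S.starProjection (f x) := by
    rw [Submodule.starProjection_apply, ← b.sum_repr (S.orthogonalProjectionOnto (f x))]
    simp [P, coord, -Module.Basis.sum_repr]
  refine ⟨P, M.sum_mem fun i _ => h _ _, ?_⟩
  refine ((ContinuousMap.dist_le (half_pos hε).le).2 fun x => ?_).trans_lt (half_lt_self hε)
  obtain ⟨y, hy, hxy⟩ := Set.mem_iUnion₂.1 (ht ⟨x, rfl⟩)
  rw [hP, dist_eq_norm, S.starProjection_minimal]
  refine (ciInf_le ⟨0, ?_⟩ (⟨y, Submodule.subset_span hy⟩ : S)).trans ?_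
  · rintro _ ⟨z, rfl⟩
    positivity
  · rw [← dist_eq_norm]
    exact (Metric.mem_ball.1 hxy).le

/-- The exponential `v ↦ exp ⟪w, v⟫` of a continuous linear functional, restricted to `C`. -/
noncomputable def expInner {X : Type*} [NormedAddCommGroup X] [InnerProductSpace ℝ X] (C : Set X)
    (w : X) : C(C, ℝ) :=
  ⟨fun v => Real.exp (inner ℝ w (v : X)), by fun_prop⟩

theorem topologicalClosure_span_range_expInner {X : Type*} [NormedAddCommGroup X]
    [InnerProductSpace ℝ X] (C : Set X) [CompactSpace C] :
    (Submodule.span ℝ (Set.range (expInner C))).topologicalClosure = ⊤ := by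
  let E : Submonoid C(C, ℝ) :=
    { carrier := Set.range (expInner C)
      one_mem' := ⟨0, by ext v; simp [expInner]⟩
      mul_mem' := by
        rintro _ _ ⟨w, rfl⟩ ⟨w', rfl⟩
        exact ⟨w + w', by ext v; simp [expInner, inner_add_left, Real.exp_add]⟩ }
  let A : Subalgebra ℝ C(C, ℝ) := Algebra.adjoin ℝ (E : Set C(C, ℝ))
  have hA : Subalgebra.toSubmodule A = Submodule.span ℝ (Set.range (expInner C)) := by
    rw [Algebra.adjoin_eq_span, Submonoid.closure_eq]
    rfl
  have hsep : A.SeparatesPoints := by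
    intro v v' hne
    refine ⟨expInner C ((v : X) - v'), ⟨_, Algebra.subset_adjoin ⟨_, rfl⟩, rfl⟩, fun heq => hne ?_⟩
    have h := Real.exp_injective heq
    rw [← sub_eq_zero, ← inner_sub_right, inner_self_eq_zero, sub_eq_zero] at h
    exact Subtype.ext h
  have htop := ContinuousMap.subalgebra_topologicalClosure_eq_top_of_separatesPoints A hsep
  rw [← hA, SetLike.ext'_iff]
  exact congrArg (fun B : Subalgebra ℝ C(C, ℝ) => (B : Set C(C, ℝ))) htop

theorem exists_finsupp_sum_exp_inner_smul_approx {X Y : Type*} [NormedAddCommGroup X]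
    [InnerProductSpace ℝ X] [NormedAddCommGroup Y] [InnerProductSpace ℝ Y] {C : Set X}
    (hC : IsCompact C) {f : X → Y} (hf : ContinuousOn f C) {ε : ℝ} (hε : 0 < ε) :
    ∃ c : X →₀ Y, ∀ v ∈ C, ‖f v - c.sum fun w y => Real.exp (inner ℝ w v) • y‖ ≤ ε := by
  have : CompactSpace C := isCompact_iff_compactSpace.1 hC
  let Φ (g : C(C, ℝ)) : Y →ₗ[ℝ] C(C, Y) :=
    { toFun := fun y => g • ContinuousMap.const C y
      map_add' := fun y y' => by ext; simp
      map_smul' := fun r y => by ext; simp [smul_comm r] }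
  let Ψ : (X →₀ Y) →ₗ[ℝ] C(C, Y) := Finsupp.lsum ℝ fun w => Φ (expInner C w)
  have htop : Ψ.range.topologicalClosure = ⊤ := by
    refine ContinuousMap.submodule_eq_top_of_smul_const_mem _
      (Submodule.isClosed_topologicalClosure _) fun g y => ?_
    let L : C(C, ℝ) →ₗ[ℝ] C(C, Y) :=
      { toFun := fun g => g • ContinuousMap.const C y
        map_add' := fun g g' => by ext; simp [add_smul]
        map_smul' := fun r g => by ext; simp [mul_smul] }
    have hL : Continuous L := by
      refine ContinuousMap.continuous_of_continuous_uncurry _ ?_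
      change Continuous fun p : C(C, ℝ) × C => p.1 p.2 • y
      fun_prop
    have hg : g ∈ (Submodule.span ℝ (Set.range (expInner C))).topologicalClosure := by
      rw [topologicalClosure_span_range_expInner]
      trivial
    refine map_mem_closure (f := L) hL hg fun g' hg' => ?_
    have hle : Submodule.span ℝ (Set.range (expInner C)) ≤ Ψ.range.comap L := by
      rw [Submodule.span_le]
      rintro _ ⟨w, rfl⟩
      exact ⟨Finsupp.single w y, by simp [Ψ, Φ, L]⟩
    exact hle hg'
  let F : C(C, Y) := ⟨C.domRestrict f, hf.domRestrict⟩
  have hF : F ∈ Ψ.range.topologicalClosure := htop ▸ trivial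
  obtain ⟨_, ⟨c, rfl⟩, hc⟩ := Metric.mem_closure_iff.1 hF ε hε
  refine ⟨c, fun v hv => ?_⟩
  have h := (ContinuousMap.dist_apply_le_dist (⟨v, hv⟩ : C)).trans hc.le
  have hsum : Ψ c ⟨v, hv⟩ = c.sum fun w y => Real.exp (inner ℝ w v) • y := by
    simp [Ψ, Φ, Finsupp.sum, expInner]
  rwa [dist_eq_norm, hsum] at h

theorem integral_exp_mul_relu {R s : ℝ} (hs : s ∈ Set.Icc (-R) R) :
    ∫ b in (-R)..R, Real.exp b * max (s - b) 0 =
      Real.exp s - Real.exp (-R) * (1 + (s + R)) := by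
  have hcont : Continuous fun b => Real.exp b * max (s - b) 0 := by fun_prop
  rw [← intervalIntegral.integral_add_adjacent_intervals (hcont.intervalIntegrable (-R) s)
    (hcont.intervalIntegrable s R)]
  have hleft : ∫ b in (-R)..s, Real.exp b * max (s - b) 0 =
      ∫ b in (-R)..s, Real.exp b * (s - b) := by
    refine intervalIntegral.integral_congr fun b hb => ?_
    rw [Set.uIcc_of_le hs.1] at hb
    simp [max_eq_left (sub_nonneg.2 hb.2)]
  have hright : ∫ b in s..R, Real.exp b * max (s - b) 0 = ∫ b in s..R, 0 := by
    refine intervalIntegral.integral_congr fun b hb => ?_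
    rw [Set.uIcc_of_le hs.2] at hb
    simp [max_eq_right (sub_nonpos.2 hb.1)]
  have hderiv (b : ℝ) :
      HasDerivAt (fun b => Real.exp b * (s - b + 1)) (Real.exp b * (s - b)) b := by
    have h := (Real.hasDerivAt_exp b).mul (((hasDerivAt_id b).const_sub s).add_const 1)
    exact h.congr_deriv (by simp; ring)
  rw [hleft, hright, intervalIntegral.integral_eq_sub_of_hasDerivAt (fun b _ => hderiv b)
    (Continuous.intervalIntegrable (by fun_prop) _ _)]
  simp
  ring

theorem integral_unitInterval_exp_mul_relu {R s : ℝ} (hs : s ∈ Set.Icc (-R) R) :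
    ∫ t : unitInterval, 2 * R * Real.exp (2 * R * t - R) * max (s - (2 * R * t - R)) 0 =
      Real.exp s - Real.exp (-R) * (1 + (s + R)) := by
  rw [← integral_exp_mul_relu hs]
  have h := unitInterval.measurePreserving_coe.integral_comp
    unitInterval.measurableEmbedding_coe
    (fun t => 2 * R * Real.exp (2 * R * t - R) * max (s - (2 * R * t - R)) 0)
  rw [h, MeasureTheory.integral_Icc_eq_integral_Ioc, ← intervalIntegral.integral_of_le zero_le_one]
  have h' := intervalIntegral.mul_integral_comp_mul_sub (a := 0) (b := 1)
    (f := fun b => Real.exp b * max (s - b) 0) (2 * R) R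
  rw [← intervalIntegral.integral_const_mul] at h'
  convert h' using 1
  · simp only [mul_assoc]
  · congr 1 <;> ring

/-- Integration against a continuous density, as a continuous linear functional. -/
noncomputable def integralDensityCLM (g : C(unitInterval, ℝ)) : C(unitInterval, ℝ) →L[ℝ] ℝ :=
  LinearMap.mkContinuous
    { toFun := fun h => ∫ t, g t * h t
      map_add' := fun h h' => by
        have h_integral (h : C(unitInterval, ℝ)) : MeasureTheory.Integrable fun t => g t * h t :=
          (g * h).continuous.integrable_of_hasCompactSupport (HasCompactSupport.of_compactSpace _)
        simp only [ContinuousMap.add_apply, mul_add]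
        exact MeasureTheory.integral_add (h_integral h) (h_integral h')
      map_smul' := fun r h => by
        simp only [ContinuousMap.smul_apply, smul_eq_mul, mul_left_comm _ r, RingHom.id_apply]
        exact MeasureTheory.integral_const_mul _ _ }
    ‖g‖ fun h => by
      refine (MeasureTheory.norm_integral_le_of_norm_le_const (C := ‖g‖ * ‖h‖)
        (.of_forall fun t => ?_)).trans ?_
      · exact ((g * h).norm_coe_le_norm t).trans (norm_mul_le g h)
      · simp

/-- The affine parametrization `t ↦ 2 R t - R` of `[-R, R]`. -/
noncomputable def affineParam (R : ℝ) : LatentZ := ⟨fun t => 2 * R * t - R, by fun_prop⟩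

/-- The density `t ↦ 2 R exp (2 R t - R)`. -/
noncomputable def expDensity (R : ℝ) : LatentZ :=
  ⟨fun t => 2 * R * Real.exp (2 * R * t - R), by fun_prop⟩

/-- The function `t ↦ 1 - t`. -/
noncomputable def oneSubParam : LatentZ := ⟨fun t => 1 - t, by fun_prop⟩

/-- The increment `u ↦ u 1 - u 0`, as a constant function. -/
noncomputable def incrementCLM : LatentZ →L[ℝ] LatentZ :=
  (ContinuousMap.evalCLM ℝ 1 - ContinuousMap.evalCLM ℝ 0 : LatentZ →L[ℝ] ℝ).smulRight 1

/-- The linear part of the operator sending `t ↦ max (s - (2 R t - R)) 0` to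
`t ↦ exp s - s (1 - t)`. -/
noncomputable def expReadoutCLM (R : ℝ) : LatentZ →L[ℝ] LatentZ :=
  (integralDensityCLM (expDensity R) + Real.exp (-R) • ContinuousMap.evalCLM ℝ 0).smulRight 1 -
    (ContinuousMap.evalCLM ℝ 0).smulRight oneSubParam

theorem zRelu_apply (f : LatentZ) (t : unitInterval) : zRelu f t = max (f t) 0 := rfl

theorem exp_sub_mul_nonneg (s : ℝ) (t : unitInterval) : 0 ≤ Real.exp s - s * (1 - t) := by
  nlinarith [Real.add_one_le_exp s, mul_nonneg t.2.1 (Real.exp_pos s).le,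
    mul_nonneg (sub_nonneg.2 t.2.2) (sub_nonneg.2 (Real.add_one_le_exp s)), t.2.2]

/-- The two-layer operator replaces each component of increment `s` by the nonnegative function
`t ↦ exp s - s (1 - t)`, which has the same increment and takes the value `exp s` at `1`. -/
theorem opLayer_expReadout_apply {m : ℕ} {R : ℝ} {u : Fin m → LatentZ} {j : Fin m}
    (hu : u j 1 - u j 0 ∈ Set.Icc (-R) R) (t : unitInterval) :
    opLayer (ContinuousLinearMap.piMap fun _ : Fin m => expReadoutCLM R)
        (fun _ => Real.exp (-R) • 1 + R • oneSubParam)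
        (opLayer (ContinuousLinearMap.piMap fun _ : Fin m => incrementCLM)
          (fun _ => -affineParam R) u) j t =
      Real.exp (u j 1 - u j 0) - (u j 1 - u j 0) * (1 - t) := by
  set s := u j 1 - u j 0 with hs
  set h := opLayer (ContinuousLinearMap.piMap fun _ : Fin m => incrementCLM)
    (fun _ => -affineParam R) u with hh
  have hrelu (t : unitInterval) : h j t = max (s - (2 * R * t - R)) 0 := by
    simp [hh, hs, opLayer, vRelu, zRelu_apply, incrementCLM, affineParam, sub_eq_add_neg]
  have hzero : h j 0 = s + R := by
    rw [hrelu, max_eq_left (by simpa using neg_le_iff_add_nonneg.1 hu.1)]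
    simp
  have h_integral : integralDensityCLM (expDensity R) (h j) =
      Real.exp s - Real.exp (-R) * (1 + (s + R)) := by
    rw [← integral_unitInterval_exp_mul_relu hu]
    change ∫ t, expDensity R t * h j t = _
    simp only [hrelu]
    rfl
  change zRelu (expReadoutCLM R (h j) + (Real.exp (-R) • 1 + R • oneSubParam)) t = _
  have hval : (expReadoutCLM R (h j) + (Real.exp (-R) • 1 + R • oneSubParam) : LatentZ) t =
      Real.exp s - s * (1 - t) := by
    simp [expReadoutCLM, h_integral, hzero, oneSubParam]
    ring
  rw [zRelu_apply, hval, max_eq_left (exp_sub_mul_nonneg s t)]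

theorem iterate_expReadout_apply_one {m : ℕ} {R : ℝ} {u : Fin m → LatentZ} {s : Fin m → ℝ}
    (hu : ∀ j, u j 1 - u j 0 = s j) (hs : ∀ j, s j ∈ Set.Icc (-R) R) {n : ℕ} (hn : n ≠ 0)
    (j : Fin m) :
    (fun v => opLayer (ContinuousLinearMap.piMap fun _ : Fin m => expReadoutCLM R)
        (fun _ => Real.exp (-R) • 1 + R • oneSubParam)
        (opLayer (ContinuousLinearMap.piMap fun _ : Fin m => incrementCLM)
          (fun _ => -affineParam R) v))^[n] u j 1 = Real.exp (s j) := by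
  set G : (Fin m → LatentZ) → (Fin m → LatentZ) := fun v =>
    opLayer (ContinuousLinearMap.piMap fun _ : Fin m => expReadoutCLM R)
      (fun _ => Real.exp (-R) • 1 + R • oneSubParam)
      (opLayer (ContinuousLinearMap.piMap fun _ : Fin m => incrementCLM)
        (fun _ => -affineParam R) v) with hG
  have hstep {v : Fin m → LatentZ} (hv : ∀ j, v j 1 - v j 0 = s j) (j : Fin m)
      (t : unitInterval) : G v j t = Real.exp (s j) - s j * (1 - t) := by
    rw [hG, opLayer_expReadout_apply (by rw [hv]; exact hs j), hv]
  have hinv (k : ℕ) : ∀ j, G^[k] u j 1 - G^[k] u j 0 = s j := by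
    induction k with
    | zero => exact hu
    | succ k ih =>
      intro j
      rw [Function.iterate_succ_apply', hstep ih, hstep ih]
      simp
  obtain ⟨k, rfl⟩ := Nat.exists_eq_succ_of_ne_zero hn
  rw [Function.iterate_succ_apply', hstep (hinv k)]
  simp

/-- **Quantitative error reduction for self-composing neural operators
(Theorem 2.3).**  Let `X, Y` be real Hilbert spaces with `X` separable,
`C ⊆ X` compact, and `O* : X → Y` Lipschitz on `C`.  Then for every `ε > 0`
there exist positive integers `Ñ, N, L` (independent of `n`) and a constant
`C_ε > 0` (independent of `n`) such that for every `n ≥ 2` there exist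
continuous linear maps `𝓛 : X → Z^Ñ`, `𝓟 : Z^Ñ → Y` and a ReLU neural
operator `G(v) = σ(W^L σ(⋯ σ(W¹ v + B¹) ⋯) + B^L)` (with
`W¹ : Z^Ñ → Z^N`, `L − 2` middle layers `Wˡ : Z^N → Z^N`, and
`W^L : Z^N → Z^Ñ`) such that
`sup_{v ∈ C} ‖O*(v) − 𝓟 (G^[n] (𝓛 v))‖ ≤ ε + C_ε / log n`. -/
theorem quantitative_error_reduction_self_composing_neural_operator
    {X Y : Type*}
    [NormedAddCommGroup X] [InnerProductSpace ℝ X] [CompleteSpace X]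
    [TopologicalSpace.SeparableSpace X]
    [NormedAddCommGroup Y] [InnerProductSpace ℝ Y] [CompleteSpace Y]
    (C : Set X) (hC : IsCompact C) (Ostar : X → Y)
    (K : NNReal) (hLip : LipschitzOnWith K Ostar C)
    (ε : ℝ) (hε : 0 < ε) :
    ∃ (Ntil N L : ℕ), 0 < Ntil ∧ 0 < N ∧ 0 < L ∧
      ∃ Cε : ℝ, 0 < Cε ∧
        ∀ n : ℕ, 2 ≤ n →
          ∃ (𝓛 : X →L[ℝ] (Fin Ntil → LatentZ))
            (𝓟 : (Fin Ntil → LatentZ) →L[ℝ] Y)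
            (W1 : (Fin Ntil → LatentZ) →L[ℝ] (Fin N → LatentZ))
            (B1 : Fin N → LatentZ)
            (Wmid : Fin (L - 2) → ((Fin N → LatentZ) →L[ℝ] (Fin N → LatentZ)))
            (Bmid : Fin (L - 2) → (Fin N → LatentZ))
            (WL : (Fin N → LatentZ) →L[ℝ] (Fin Ntil → LatentZ))
            (BL : Fin Ntil → LatentZ),
            ∀ v ∈ C,
              ‖Ostar v -
                  𝓟 ((fun h => opLayer WL BL
                        (midStack (L - 2) Wmid Bmid (opLayer W1 B1 h)))^[n]
                      (𝓛 v))‖ ≤ ε + Cε / Real.log n := by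
  obtain ⟨c, hc⟩ := exists_finsupp_sum_exp_inner_smul_approx hC hLip.continuousOn hε
  classical
  let T : Finset X := insert 0 c.support
  let e := T.equivFin
  obtain ⟨r, hr⟩ := isBounded_iff_forall_norm_le.1 hC.isBounded
  let w : Fin T.card → X := fun j => e.symm j
  let R : ℝ := ∑ j, ‖w j‖ * r
  have hR {v : X} (hv : v ∈ C) (j : Fin T.card) : inner ℝ (w j) v ∈ Set.Icc (-R) R := by
    have hr0 : 0 ≤ r := (norm_nonneg v).trans (hr v hv)
    refine abs_le.1 ((abs_real_inner_le_norm _ _).trans ?_)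
    exact (mul_le_mul_of_nonneg_left (hr v hv) (norm_nonneg _)).trans
      (Finset.single_le_sum (f := fun j => ‖w j‖ * r)
        (fun i _ => mul_nonneg (norm_nonneg _) hr0) (Finset.mem_univ j))
  have hT : 0 < T.card := Finset.card_pos.2 (Finset.insert_nonempty _ _)
  refine ⟨T.card, T.card, 2, hT, hT, two_pos, 1, one_pos, fun n hn => ?_⟩
  let ramp : LatentZ := ⟨fun t => t, by fun_prop⟩
  refine ⟨ContinuousLinearMap.pi fun j => (innerSL ℝ (w j)).smulRight ramp,
    ∑ j, ((ContinuousMap.evalCLM ℝ 1).smulRight (c (w j))) ∘L ContinuousLinearMap.proj j,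
    ContinuousLinearMap.piMap fun _ => incrementCLM, fun _ => -affineParam R,
    fun _ => 0, fun _ => 0,
    ContinuousLinearMap.piMap fun _ => expReadoutCLM R,
    fun _ => Real.exp (-R) • 1 + R • oneSubParam, fun v hv => ?_⟩
  have hsum : (c.sum fun w y => Real.exp (inner ℝ w v) • y) =
      ∑ j, Real.exp (inner ℝ (w j) v) • c (w j) := by
    rw [Finsupp.sum_of_support_subset c (Finset.subset_insert 0 c.support) _ (by simp),
      ← Finset.sum_coe_sort]
    exact (e.symm.sum_comp fun x : T => Real.exp (inner ℝ (x : X) v) • c x).symm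
  have hlog : 0 ≤ 1 / Real.log n := one_div_nonneg.2 (Real.log_natCast_nonneg n)
  refine le_trans (le_of_eq ?_) ((hc v hv).trans (le_add_of_nonneg_right hlog))
  rw [hsum]
  congr 2
  simp only [sum_apply, ContinuousLinearMap.comp_apply, ContinuousLinearMap.proj_apply,
    ContinuousLinearMap.smulRight_apply, ContinuousMap.evalCLM_apply]
  refine Finset.sum_congr rfl fun j _ => congrArg (· • c (w j)) ?_
  refine iterate_expReadout_apply_one (s := fun j => inner ℝ (w j) v) (fun j => ?_) (hR hv)
    (by lia) j
  simp [ramp]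
end
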